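/- arXiv:1010.4627 — 2 statements merged into one kernel-verified Lean document; each statement's English description precedes it below -/
import Mathlib

section
/- Every nonnegative polynomial V on ℝⁿ, not identically zero, satisfies the reverse Hölder inequality RH_q for every 1 < q < ∞. -/
open MeasureTheory Set
open scoped ENNReal

noncomputable section

/-- On a finite-dimensional space of continuous functions, the sup norm is controlled by the
`L¹` norm. -/
theorem sup_le_L1_of_fg {K : Type*} [TopologicalSpace K] [CompactSpace K] [MeasurableSpace K]
    [BorelSpace K] (μ : Measure K) [IsFiniteMeasure μ] [μ.IsOpenPosMeasure]
    (W : Submodule ℝ C(K, ℝ)) (hW : W.FG) :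
    ∃ C > 0, ∀ f ∈ W, ‖f‖ ≤ C * ∫ x, |f x| ∂μ := by
  have : FiniteDimensional ℝ W := Module.Finite.iff_fg.2 hW
  have : ProperSpace W := FiniteDimensional.proper ℝ W
  have hint : ∀ f : C(K, ℝ), Integrable (fun x => f x) μ := fun f =>
    f.continuous.integrable_of_hasCompactSupport (HasCompactSupport.of_compactSpace _)
  have hcont : Continuous (fun f : W => ∫ x, |(f : C(K, ℝ)) x| ∂μ) := by
    have h : LipschitzWith (μ.real univ).toNNReal (fun f : W => ∫ x, |(f : C(K, ℝ)) x| ∂μ) := by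
      apply LipschitzWith.of_dist_le_mul
      intro f g
      rw [Real.coe_toNNReal _ measureReal_nonneg, Real.dist_eq,
        ← integral_sub (hint f.1).abs (hint g.1).abs, mul_comm, ← Real.norm_eq_abs]
      refine norm_integral_le_of_norm_le_const (μ := μ) (Filter.Eventually.of_forall fun x => ?_)
      rw [Real.norm_eq_abs]
      refine (abs_abs_sub_abs_le_abs_sub _ _).trans ?_
      have := ContinuousMap.dist_apply_le_dist (f := f.1) (g := g.1) x
      rwa [Real.dist_eq] at this
    exact h.continuous
  have key : ∃ m > 0, ∀ f ∈ Metric.sphere (0 : W) 1, m ≤ ∫ x, |(f : C(K, ℝ)) x| ∂μ := by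
    rcases (Metric.sphere (0 : W) 1).eq_empty_or_nonempty with he | hne
    · exact ⟨1, one_pos, by simp [he]⟩
    · obtain ⟨f₀, hf₀, hmin⟩ := (isCompact_sphere (0 : W) 1).exists_isMinOn hne hcont.continuousOn
      refine ⟨_, ?_, fun f hf => hmin hf⟩
      have hne0 : (f₀ : C(K, ℝ)) ≠ 0 := by
        intro h
        have : f₀ = 0 := Subtype.ext h
        simp [this] at hf₀
      obtain ⟨x, hx⟩ := DFunLike.ne_iff.1 hne0
      exact integral_pos_of_integrable_nonneg_nonzero (x := x) (f₀.1.continuous.abs)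
        (hint f₀.1).abs (fun y => abs_nonneg _) (by simpa using hx)
  obtain ⟨m, hm, hmf⟩ := key
  refine ⟨m⁻¹, inv_pos.2 hm, fun f hf => ?_⟩
  by_cases h0 : f = 0
  · simp [h0]
  have hn : 0 < ‖f‖ := norm_pos_iff.2 h0
  have h1 := hmf (‖f‖⁻¹ • ⟨f, hf⟩) (by
    rw [mem_sphere_zero_iff_norm]
    change ‖(‖f‖⁻¹ • f : C(K, ℝ))‖ = 1
    rw [norm_smul, norm_inv, norm_norm]
    exact inv_mul_cancel₀ hn.ne')
  simp only [Submodule.coe_smul, ContinuousMap.coe_smul, Pi.smul_apply, smul_eq_mul, abs_mul,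
    abs_inv, abs_norm, integral_const_mul] at h1
  rw [← div_eq_inv_mul, le_div_iff₀ hn] at h1
  rw [← div_eq_inv_mul, le_div_iff₀ hm]
  linarith

/-- The rescaled polynomial as a continuous function on a subset. -/
def rescale {n : ℕ} (K : Set (EuclideanSpace ℝ (Fin n))) (V : MvPolynomial (Fin n) ℝ)
    (x₀ : EuclideanSpace ℝ (Fin n)) (r : ℝ) : C(K, ℝ) where
  toFun x := MvPolynomial.eval (fun i => (x₀ + r • (x : EuclideanSpace ℝ (Fin n))) i) V
  continuous_toFun := by
    refine (MvPolynomial.continuous_eval V).comp ?_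
    fun_prop

theorem rescale_mem {n : ℕ} (K : Set (EuclideanSpace ℝ (Fin n))) (V : MvPolynomial (Fin n) ℝ) :
    ∃ W : Submodule ℝ C(K, ℝ), W.FG ∧ ∀ x₀ r, rescale K V x₀ r ∈ W := by
  induction V using MvPolynomial.induction_on with
  | C a =>
    refine ⟨Submodule.span ℝ {1}, Submodule.fg_span_singleton _, fun x₀ r => ?_⟩
    refine Submodule.mem_span_singleton.2 ⟨a, ?_⟩
    ext x
    simp [rescale]
  | add p q hp hq =>
    obtain ⟨W₁, h₁, H₁⟩ := hp
    obtain ⟨W₂, h₂, H₂⟩ := hq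
    refine ⟨W₁ ⊔ W₂, h₁.sup h₂, fun x₀ r => ?_⟩
    have : rescale K (p + q) x₀ r = rescale K p x₀ r + rescale K q x₀ r := by
      ext x
      simp [rescale]
    rw [this]
    exact Submodule.add_mem_sup (H₁ _ _) (H₂ _ _)
  | mul_X p i hp =>
    obtain ⟨W₁, h₁, H₁⟩ := hp
    let c : C(K, ℝ) := ⟨fun x => (x : EuclideanSpace ℝ (Fin n)) i, by fun_prop⟩
    refine ⟨W₁ * Submodule.span ℝ {1, c}, h₁.mul (Submodule.fg_span (by simp)), fun x₀ r => ?_⟩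
    have : rescale K (p * MvPolynomial.X i) x₀ r
        = rescale K p x₀ r * (x₀ i • (1 : C(K, ℝ)) + r • c) := by
      ext x
      simp [rescale, c]
    rw [this]
    exact Submodule.mul_mem_mul (H₁ _ _) (Submodule.mem_span_pair.2 ⟨_, _, rfl⟩)

/-- Change of variables on balls. -/
theorem integral_rescale {n : ℕ} (g : EuclideanSpace ℝ (Fin n) → ℝ)
    (x₀ : EuclideanSpace ℝ (Fin n)) {r : ℝ} (hr : 0 < r) :
    ∫ x in Metric.closedBall (0 : EuclideanSpace ℝ (Fin n)) 1, g (x₀ + r • x)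
      = (r ^ n)⁻¹ * ∫ x in Metric.ball x₀ r, g x := by
  have hae : (Metric.ball (0 : EuclideanSpace ℝ (Fin n)) 1 : Set _)
      =ᵐ[volume] Metric.closedBall (0 : EuclideanSpace ℝ (Fin n)) 1 := by
    refine (ae_le_set.2 ?_).antisymm (ae_le_set.2 ?_)
    · rw [sdiff_eq_bot_iff.2 Metric.ball_subset_closedBall]; simp
    · rw [Metric.closedBall_sdiff_ball]
      exact Measure.addHaar_sphere_of_ne_zero _ _ one_ne_zero
  rw [← setIntegral_congr_set hae]
  have h1 := Measure.setIntegral_comp_smul_of_pos (volume : Measure (EuclideanSpace ℝ (Fin n)))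
    (fun y => g (x₀ + y)) (Metric.ball 0 1) hr
  rw [smul_unitBall_of_pos hr, finrank_euclideanSpace_fin, smul_eq_mul] at h1
  rw [h1]
  congr 1
  have h2 := (measurePreserving_add_left (volume : Measure (EuclideanSpace ℝ (Fin n)))
    x₀).setIntegral_preimage_emb (measurableEmbedding_addLeft x₀) g (Metric.ball x₀ r)
  rw [← h2]
  congr 2
  ext y
  simp [dist_eq_norm]

theorem openPos_closedBall {n : ℕ} :
    (Measure.comap (Subtype.val : Metric.closedBall (0 : EuclideanSpace ℝ (Fin n)) 1 → _)
      volume).IsOpenPosMeasure := by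
  refine ⟨fun U hU hne => ?_⟩
  obtain ⟨O, hO, rfl⟩ := isOpen_induced_iff.1 hU
  obtain ⟨⟨x, hx⟩, hxO⟩ := hne
  rw [comap_subtype_coe_apply Metric.isClosed_closedBall.measurableSet,
    Subtype.image_preimage_coe]
  rw [← closure_ball _ one_ne_zero] at hx
  have h := mem_closure_iff.1 hx O hO hxO
  refine ne_of_gt (lt_of_lt_of_le ((hO.inter Metric.isOpen_ball).measure_pos volume h)
    (measure_mono ?_))
  rw [inter_comm]
  exact inter_subset_inter_left _ Metric.ball_subset_closedBall

/-- every nonnegative polynomial `V` on `ℝⁿ`, not identically zero,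
satisfies the reverse Hölder inequality `RH_q` for every `1 < q < ∞`:
there is `C > 0` such that for every ball `B`,
`(|B|⁻¹ ∫_B V^q)^{1/q} ≤ C |B|⁻¹ ∫_B V`. -/
theorem polynomial_reverseHolder (n : ℕ) (hn : 1 ≤ n) (V : MvPolynomial (Fin n) ℝ)
    (hVnonneg : ∀ x : Fin n → ℝ, 0 ≤ MvPolynomial.eval x V) (hV0 : V ≠ 0)
    (q : ℝ) (hq : 1 < q) :
    ∃ C > 0, ∀ (x₀ : EuclideanSpace ℝ (Fin n)) (r : ℝ), 0 < r →
      (((volume (Metric.ball x₀ r)).toReal)⁻¹ *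
          ∫ x in Metric.ball x₀ r, (MvPolynomial.eval (fun i => x i) V) ^ q) ^ (1 / q)
        ≤ C * (((volume (Metric.ball x₀ r)).toReal)⁻¹ *
            ∫ x in Metric.ball x₀ r, MvPolynomial.eval (fun i => x i) V) := by
  let K : Set (EuclideanSpace ℝ (Fin n)) := Metric.closedBall 0 1
  have hKm : MeasurableSet K := Metric.isClosed_closedBall.measurableSet
  have : CompactSpace K := isCompact_iff_compactSpace.1 (isCompact_closedBall _ _)
  let μ : Measure K := Measure.comap Subtype.val volume
  have : IsFiniteMeasure μ := ⟨by
    rw [comap_subtype_coe_apply hKm, image_univ, Subtype.range_coe]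
    exact (isCompact_closedBall _ _).measure_lt_top⟩
  have : μ.IsOpenPosMeasure := openPos_closedBall
  obtain ⟨W, hW, hmem⟩ := rescale_mem K V
  obtain ⟨C, hC, hbound⟩ := sup_le_L1_of_fg μ W hW
  set v : ℝ := (volume (Metric.ball (0 : EuclideanSpace ℝ (Fin n)) 1)).toReal with hv
  have hvpos : 0 < v := ENNReal.toReal_pos (Metric.measure_ball_pos _ _ one_pos).ne'
    measure_ball_lt_top.ne
  refine ⟨C * v, mul_pos hC hvpos, fun x₀ r hr => ?_⟩
  have hq0 : 0 < q := by linarith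
  have hb := hbound _ (hmem x₀ r)
  set M := ‖rescale K V x₀ r‖ with hM
  have hM0 : 0 ≤ M := norm_nonneg _
  have hI : ∫ x, |rescale K V x₀ r x| ∂μ
      = (r ^ n)⁻¹ * ∫ x in Metric.ball x₀ r, MvPolynomial.eval (fun i => x i) V := by
    rw [← integral_rescale _ x₀ hr]
    rw [← integral_subtype_comap hKm]
    refine integral_congr_ae (Filter.Eventually.of_forall fun x => ?_)
    exact abs_of_nonneg (hVnonneg _)
  have hvol : (volume (Metric.ball x₀ r)).toReal = r ^ n * v := by
    rw [Measure.addHaar_ball_of_pos _ _ hr, ENNReal.toReal_mul, ENNReal.toReal_ofReal (by positivity),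
      finrank_euclideanSpace_fin]
  have hvr : 0 < (volume (Metric.ball x₀ r)).toReal := by rw [hvol]; positivity
  have hpt : ∀ x ∈ Metric.ball x₀ r, MvPolynomial.eval (fun i => x i) V ≤ M := by
    intro x hx
    have hy : r⁻¹ • (x - x₀) ∈ K := by
      rw [mem_closedBall_zero_iff, norm_smul, norm_inv, Real.norm_of_nonneg hr.le, ← div_eq_inv_mul,
        div_le_one hr]
      rw [mem_ball_iff_norm] at hx
      exact hx.le
    have h := (rescale K V x₀ r).norm_coe_le_norm ⟨_, hy⟩
    refine le_trans (le_of_eq ?_) ((le_abs_self _).trans h)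
    simp only [rescale, ContinuousMap.coe_mk]
    rw [smul_inv_smul₀ hr.ne', add_sub_cancel]
  have hq1 : ∫ x in Metric.ball x₀ r, (MvPolynomial.eval (fun i => x i) V) ^ q
      ≤ M ^ q * (volume (Metric.ball x₀ r)).toReal := by
    refine (le_abs_self _).trans ?_
    rw [← Real.norm_eq_abs]
    refine norm_setIntegral_le_of_norm_le_const measure_ball_lt_top ?_
    intro x hx
    rw [Real.norm_of_nonneg (Real.rpow_nonneg (hVnonneg _) _)]
    exact Real.rpow_le_rpow (hVnonneg _) (hpt x hx) hq0.le
  have hq2 : 0 ≤ ∫ x in Metric.ball x₀ r, (MvPolynomial.eval (fun i => x i) V) ^ q :=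
    integral_nonneg fun x => Real.rpow_nonneg (hVnonneg _) _
  calc _ ≤ (M ^ q) ^ (1 / q) := by
        refine Real.rpow_le_rpow (by positivity) ?_ (by positivity)
        rw [← div_eq_inv_mul, div_le_iff₀ hvr]
        exact hq1
    _ = M := by rw [one_div, Real.rpow_rpow_inv hM0 hq0.ne']
    _ ≤ _ := hb
    _ = _ := by
      rw [hI, hvol]
      field_simp

end
end

section
/- Let f ∈ BMO(ℝⁿ), B = B(x_0, r_0), f_2 = (f - f_B)χ_{(B^{**})^c} and 1 < s < ∞. Then for every x ∈ B, (∫_{ℝⁿ} |f_2(y)|^s / |x - y|^{n+s-1} dy)^{1/s} r_0^{1/s'} ≤ C ‖f‖_{BMO(ℝⁿ)}, where 1/s + 1/s' = 1 and C depends only on n and s. -/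
open MeasureTheory Set
open scoped ENNReal

noncomputable section

/-- The average of `f` over a set `s` (with respect to Lebesgue measure). -/
def avgOn {n : ℕ} (f : EuclideanSpace ℝ (Fin n) → ℝ) (s : Set (EuclideanSpace ℝ (Fin n))) : ℝ :=
  ((volume s).toReal)⁻¹ * ∫ y in s, f y

/-- `f` has BMO norm at most `M`: the mean oscillation of `f` over every ball is `≤ M`. -/
def IsBMOWith {n : ℕ} (f : EuclideanSpace ℝ (Fin n) → ℝ) (M : ℝ) : Prop :=
  ∀ (x₀ : EuclideanSpace ℝ (Fin n)) (r : ℝ), 0 < r →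
    ((volume (Metric.ball x₀ r)).toReal)⁻¹ *
      ∫ y in Metric.ball x₀ r, |f y - avgOn f (Metric.ball x₀ r)| ≤ M

open Filter Topology Metric

abbrev EE (n : ℕ) := EuclideanSpace ℝ (Fin n)

/-- mean deviation from the constant `a` on a ball -/
def moOn {n : ℕ} (f : EE n → ℝ) (a : ℝ) (x : EE n) (r : ℝ) : ℝ :=
  ((volume (Metric.ball x r)).toReal)⁻¹ * ∫ y in Metric.ball x r, |f y - a|

/-- volume of the unit ball -/
def vBall (n : ℕ) : ℝ := (volume (Metric.ball (0 : EE n) 1)).toReal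

lemma vBall_pos (n : ℕ) : 0 < vBall n :=
  ENNReal.toReal_pos (measure_ball_pos _ _ one_pos).ne' measure_ball_lt_top.ne

lemma vol_ball {n : ℕ} (x : EE n) {r : ℝ} (hr : 0 < r) :
    volume (ball x r) = ENNReal.ofReal (r ^ n * vBall n) := by
  rw [Measure.addHaar_ball_of_pos _ x hr, finrank_euclideanSpace, Fintype.card_fin,
    ENNReal.ofReal_mul (by positivity), vBall, ENNReal.ofReal_toReal measure_ball_lt_top.ne]

lemma vol_ball_real {n : ℕ} (x : EE n) {r : ℝ} (hr : 0 < r) :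
    (volume (ball x r)).toReal = r ^ n * vBall n := by
  have := vBall_pos n
  rw [vol_ball x hr, ENNReal.toReal_ofReal (by positivity)]

lemma intOn {n : ℕ} {f : EE n → ℝ} (hf : LocallyIntegrable f volume) (x : EE n) (r : ℝ) :
    IntegrableOn f (ball x r) volume :=
  (hf.integrableOn_isCompact (isCompact_closedBall x r)).mono_set ball_subset_closedBall

lemma locInt_sub {n : ℕ} {f : EE n → ℝ} (hf : LocallyIntegrable f volume) (a : ℝ) :
    LocallyIntegrable (fun y => |f y - a|) volume := by
  have : LocallyIntegrable (fun y => f y - a) volume := hf.sub (locallyIntegrable_const a)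
  intro x
  obtain ⟨t, ht, hi⟩ := this x
  exact ⟨t, ht, hi.norm⟩

lemma moOn_nonneg {n : ℕ} (f : EE n → ℝ) (a : ℝ) (x : EE n) (r : ℝ) : 0 ≤ moOn f a x r :=
  mul_nonneg (by positivity) (integral_nonneg fun _ => abs_nonneg _)

lemma avg_sub_le {n : ℕ} {f : EE n → ℝ} (hf : LocallyIntegrable f volume) (a : ℝ) (x : EE n)
    {r : ℝ} (hr : 0 < r) : |avgOn f (ball x r) - a| ≤ moOn f a x r := by
  have hv : 0 < (volume (ball x r)).toReal := by
    rw [vol_ball_real x hr]; have := vBall_pos n; positivity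
  have h1 : avgOn f (ball x r) - a
      = ((volume (ball x r)).toReal)⁻¹ * ∫ y in ball x r, (f y - a) := by
    rw [integral_sub (intOn hf x r) (integrableOn_const (by exact measure_ball_lt_top.ne)),
      setIntegral_const, avgOn, mul_sub, smul_eq_mul, Measure.real, inv_mul_cancel_left₀ hv.ne']
  rw [h1, abs_mul, abs_of_pos (inv_pos.2 hv), moOn]
  gcongr
  exact abs_integral_le_integral_abs

lemma moOn_mono {n : ℕ} {f : EE n → ℝ} (hf : LocallyIntegrable f volume) (a : ℝ) (x y : EE n)
    {r R c : ℝ} (hr : 0 < r) (hc : 0 < c) (hR : R = c * r) (hsub : ball y r ⊆ ball x R) :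
    moOn f a y r ≤ c ^ n * moOn f a x R := by
  have hv := vBall_pos n
  have hRp : 0 < R := by rw [hR]; positivity
  have h : ∫ z in ball y r, |f z - a| ≤ ∫ z in ball x R, |f z - a| :=
    setIntegral_mono_set (intOn (locInt_sub hf a) x R)
      (Eventually.of_forall fun _ => abs_nonneg _) hsub.eventuallyLE
  rw [moOn, moOn, vol_ball_real y hr, vol_ball_real x hRp, hR]
  rw [hR] at h
  have : c ^ n * (((c * r) ^ n * vBall n)⁻¹ * ∫ z in ball x (c * r), |f z - a|)
     = (r ^ n * vBall n)⁻¹ * ∫ z in ball x (c * r), |f z - a| := by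
    rw [mul_pow]; field_simp
  rw [this]
  gcongr

lemma moOn_le {n : ℕ} {f : EE n → ℝ} (hf : LocallyIntegrable f volume) {M : ℝ}
    (hM : IsBMOWith f M) (a : ℝ) (x : EE n) {r : ℝ} (hr : 0 < r) :
    moOn f a x r ≤ M + |avgOn f (ball x r) - a| := by
  have hv : 0 < (volume (ball x r)).toReal := by
    rw [vol_ball_real x hr]; have := vBall_pos n; positivity
  set m := avgOn f (ball x r) with hm
  have h1 : ∫ y in ball x r, |f y - a| ≤ ∫ y in ball x r, (|f y - m| + |m - a|) := by
    refine setIntegral_mono (intOn (locInt_sub hf a) x r)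
      ((intOn (locInt_sub hf m) x r).add (integrableOn_const (by exact measure_ball_lt_top.ne))) ?_
    intro y
    exact abs_sub_le _ _ _
  rw [integral_add (intOn (locInt_sub hf m) x r)
    (integrableOn_const (by exact measure_ball_lt_top.ne)), setIntegral_const] at h1
  have h2 := hM x r hr
  rw [moOn]
  calc _ ≤ ((volume (ball x r)).toReal)⁻¹ * ((∫ y in ball x r, |f y - m|)
        + (volume.real (ball x r)) • |m - a|) := by gcongr
    _ = ((volume (ball x r)).toReal)⁻¹ * (∫ y in ball x r, |f y - m|) + |m - a| := by
        rw [mul_add, smul_eq_mul, Measure.real, inv_mul_cancel_left₀ hv.ne']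
    _ ≤ _ := by gcongr

lemma avg_diff {n : ℕ} {f : EE n → ℝ} (hf : LocallyIntegrable f volume) {M : ℝ}
    (hM : IsBMOWith f M) (x y : EE n)
    {r R c : ℝ} (hr : 0 < r) (hc : 0 < c) (hR : R = c * r) (hsub : ball y r ⊆ ball x R) :
    |avgOn f (ball y r) - avgOn f (ball x R)| ≤ c ^ n * M := by
  refine (avg_sub_le hf _ y hr).trans ((moOn_mono hf _ x y hr hc hR hsub).trans ?_)
  gcongr
  exact hM x R (by rw [hR]; positivity)

lemma ae_lebesgue {n : ℕ} (hn : 1 ≤ n) {f : EE n → ℝ} (hf : LocallyIntegrable f volume) (a R : ℝ)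
    (hR : 0 < R) :
    ∀ᵐ y : EE n, Tendsto (fun j : ℕ => moOn f a y (R / 2 ^ j)) atTop (𝓝 |f y - a|) := by
  have : Nonempty (Fin n) := ⟨⟨0, hn⟩⟩
  filter_upwards [IsUnifLocDoublingMeasure.ae_tendsto_average volume (locInt_sub hf a) 1] with y hy
  have h0 : Tendsto (fun j : ℕ => R / 2 ^ j) atTop (𝓝[>] 0) := by
    refine tendsto_nhdsWithin_iff.2 ⟨?_, Eventually.of_forall fun j => by
      simp only [mem_Ioi]; positivity⟩
    have := (tendsto_pow_atTop_nhds_zero_of_lt_one (r := (1/2 : ℝ)) (by norm_num)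
      (by norm_num)).const_mul R
    simpa [div_eq_mul_inv] using this
  have := hy (fun _ : ℕ => y) (fun j => R / 2 ^ j) h0 (Eventually.of_forall fun j => by
    apply mem_closedBall_self; positivity)
  refine this.congr fun j => ?_
  have hae : (closedBall y (R / 2 ^ j) : Set (EE n)) =ᵐ[volume] ball y (R / 2 ^ j) :=
    (ae_eq_of_subset_of_measure_ge ball_subset_closedBall
      (Measure.addHaar_closedBall_eq_addHaar_ball volume y _).le
      measurableSet_ball.nullMeasurableSet measure_closedBall_lt_top.ne).symm
  rw [setAverage_congr hae, setAverage_eq, moOn, smul_eq_mul, Measure.real]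

lemma stop_radius {g : ℝ → ℝ} {R T t : ℝ} (hR : 0 < R) (h0 : g R ≤ T) (ht : T < t)
    (hl : Tendsto (fun j : ℕ => g (R / 2 ^ j)) atTop (𝓝 t)) :
    ∃ ρ, 0 < ρ ∧ ρ ≤ R ∧ T < g ρ ∧ g (2 * ρ) ≤ T := by
  classical
  have hex : ∃ j : ℕ, T < g (R / 2 ^ j) := (hl.eventually (lt_mem_nhds ht)).exists
  have h1 := Nat.find_spec hex
  have hne : Nat.find hex ≠ 0 := by
    intro h
    rw [h] at h1
    simp at h1
    linarith
  obtain ⟨k, hk⟩ := Nat.exists_eq_succ_of_ne_zero hne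
  have h2 := Nat.find_min hex (m := k) (by omega)
  rw [hk] at h1
  refine ⟨R / 2 ^ (k+1), by positivity, div_le_self hR.le (one_le_pow₀ (by norm_num)), h1, ?_⟩
  have : 2 * (R / 2 ^ (k+1)) = R / 2 ^ k := by rw [pow_succ]; field_simp
  rw [this]
  exact not_lt.1 h2

/-- distribution bound -/
def DistBd {n : ℕ} (f : EE n → ℝ) (l : ℝ) (q : ℝ≥0∞) : Prop :=
  ∀ (x : EE n) (r : ℝ), 0 < r →
    volume {y | y ∈ ball x r ∧ l < |f y - avgOn f (ball x r)|} ≤ q * volume (ball x r)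

def cA (n : ℕ) : ℝ := 1 + 2 ^ n
def cL (n : ℕ) : ℝ := 2 * 6 ^ n * (2 ^ n * cA n)
def cK (n : ℕ) : ℝ := 6 ^ n + 2 ^ n * cL n

lemma jn_step {n : ℕ} (hn : 1 ≤ n) {f : EE n → ℝ} (hf : LocallyIntegrable f volume) {M : ℝ}
    (hM0 : 0 < M) (hM : IsBMOWith f M) {l : ℝ} (hl : 0 ≤ l) {q : ℝ≥0∞} (hq : DistBd f l q) :
    DistBd f (l + cK n * M) (q / 2) := by
  intro x R hR
  set a := avgOn f (ball x R) with ha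
  have hA : 0 < cA n := by unfold cA; positivity
  have hL : 0 < cL n := by unfold cL; positivity
  have hsub0 : ball x R ⊆ ball x (2 * R) := ball_subset_ball (by linarith)
  have hmo2 : moOn f a x (2 * R) ≤ cA n * M := by
    refine (moOn_le hf hM a x (by positivity)).trans ?_
    rw [abs_sub_comm]
    have := avg_diff hf hM x x hR two_pos rfl hsub0
    rw [cA]; linarith
  have hLge : 2 ^ n * cA n ≤ cL n := by
    rw [cL]
    have : (1:ℝ) ≤ 6 ^ n := one_le_pow₀ (by norm_num)
    have h2 : 0 < 2 ^ n * cA n := by positivity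
    nlinarith
  have hKge : cL n ≤ cK n := by
    rw [cK]
    have : (1:ℝ) ≤ 2 ^ n := one_le_pow₀ (by norm_num)
    have h2 : (0:ℝ) < 6 ^ n := by positivity
    nlinarith
  set E := {y | y ∈ ball x R ∧ l + cK n * M < |f y - a|} with hE
  set G := {y : EE n | Tendsto (fun j : ℕ => moOn f a y (R / 2 ^ j)) atTop (𝓝 |f y - a|)} with hG
  have hGae : volume Gᶜ = 0 := ae_lebesgue hn hf a R hR
  have hst : ∀ y ∈ E ∩ G, ∃ ρ, 0 < ρ ∧ ρ ≤ R ∧ cL n * M < moOn f a y ρ ∧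
      moOn f a y (2 * ρ) ≤ cL n * M := by
    rintro y ⟨⟨hyB, hyE⟩, hyG⟩
    refine stop_radius (g := fun ρ => moOn f a y ρ) hR ?_ ?_ hyG
    · have hs : ball y R ⊆ ball x (2 * R) := by
        apply ball_subset_ball'
        have := mem_ball.1 hyB
        linarith
      refine (moOn_mono hf a x y hR two_pos rfl hs).trans ?_
      calc 2 ^ n * moOn f a x (2 * R) ≤ 2 ^ n * (cA n * M) := by gcongr
        _ = (2 ^ n * cA n) * M := by ring
        _ ≤ _ := by gcongr
    · have : cL n * M ≤ cK n * M := by gcongr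
      linarith
  choose! ρ hρ0 hρR hρ1 hρ2 using hst
  obtain ⟨u, hut, hdis, hcov⟩ := Vitali.exists_disjoint_subfamily_covering_enlargement_closedBall
    (E ∩ G) (fun y => y) ρ R hρR 5 (by norm_num)
  have hdis' : u.PairwiseDisjoint fun b => ball b (ρ b) :=
    hdis.mono fun _ => ball_subset_closedBall
  have hcnt : u.Countable := hdis'.countable_of_isOpen (fun _ _ => isOpen_ball)
    (fun b hb => nonempty_ball.2 (hρ0 b (hut hb)))
  have hcover : E ∩ G ⊆ ⋃ b ∈ u, {y | y ∈ ball b (6 * ρ b) ∧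
      l < |f y - avgOn f (ball b (6 * ρ b))|} := by
    intro y hy
    obtain ⟨b, hb, hyb⟩ := hcov y hy
    have hb0 := hρ0 b (hut hb)
    simp only [mem_iUnion]
    refine ⟨b, hb, ?_, ?_⟩
    · exact closedBall_subset_ball (by linarith) (hyb (mem_closedBall_self (hρ0 y hy).le))
    · have h1 : |avgOn f (ball b (ρ b)) - avgOn f (ball b (6 * ρ b))| ≤ 6 ^ n * M :=
        avg_diff hf hM b b hb0 (by norm_num) rfl (ball_subset_ball (by linarith))
      have h2 : |avgOn f (ball b (ρ b)) - a| ≤ 2 ^ n * (cL n * M) := by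
        refine (avg_sub_le hf a b hb0).trans
          ((moOn_mono hf a b b hb0 two_pos rfl (ball_subset_ball (by linarith))).trans ?_)
        have := hρ2 b (hut hb)
        gcongr
      have h3 := hy.1.2
      have h4 : cK n * M = 6 ^ n * M + 2 ^ n * (cL n * M) := by rw [cK]; ring
      have h5 := abs_sub_le (f y) (avgOn f (ball b (6 * ρ b))) a
      have h6 := abs_sub_le (avgOn f (ball b (6 * ρ b))) (avgOn f (ball b (ρ b))) a
      rw [abs_sub_comm (avgOn f (ball b (6 * ρ b))) (avgOn f (ball b (ρ b)))] at h6
      linarith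
  set S := ∑' b : u, volume (ball (b : EE n) (ρ b)) with hS
  have hS1 : volume E ≤ q * (ENNReal.ofReal (6 ^ n) * S) := by
    calc volume E ≤ volume (E ∩ G) + volume Gᶜ := by
          refine (measure_mono ?_).trans (measure_union_le _ _)
          intro y hy
          by_cases h : y ∈ G
          · exact Or.inl ⟨hy, h⟩
          · exact Or.inr h
      _ = volume (E ∩ G) := by rw [hGae, add_zero]
      _ ≤ _ := measure_mono hcover
      _ ≤ ∑' b : u, volume {y | y ∈ ball (b : EE n) (6 * ρ b) ∧
          l < |f y - avgOn f (ball (b : EE n) (6 * ρ b))|} := measure_biUnion_le _ hcnt _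
      _ ≤ ∑' b : u, q * (ENNReal.ofReal (6 ^ n) * volume (ball (b : EE n) (ρ b))) := by
          refine ENNReal.tsum_le_tsum fun b => ?_
          have hb0 := hρ0 b (hut b.2)
          refine (hq b (6 * ρ b) (by positivity)).trans_eq ?_
          rw [vol_ball _ (by positivity : 0 < 6 * ρ b), vol_ball _ hb0,
            ← ENNReal.ofReal_mul (by positivity), mul_pow, mul_assoc]
      _ = _ := by rw [ENNReal.tsum_mul_left, ENNReal.tsum_mul_left]
  have hS2 : ENNReal.ofReal (cL n * M) * S ≤
      ENNReal.ofReal (2 ^ n * cA n * M) * volume (ball x R) := by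
    calc ENNReal.ofReal (cL n * M) * S
        = ∑' b : u, ENNReal.ofReal (cL n * M) * volume (ball (b : EE n) (ρ b)) :=
          ENNReal.tsum_mul_left.symm
      _ ≤ ∑' b : u, ∫⁻ y in ball (b : EE n) (ρ b), ENNReal.ofReal |f y - a| := by
          refine ENNReal.tsum_le_tsum fun b => ?_
          have hb0 := hρ0 b (hut b.2)
          have h1 := hρ1 b (hut b.2)
          rw [← ofReal_integral_eq_lintegral_ofReal (intOn (locInt_sub hf a) _ _)
            (Eventually.of_forall fun _ => abs_nonneg _), vol_ball _ hb0,
            ← ENNReal.ofReal_mul (by positivity)]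
          apply ENNReal.ofReal_le_ofReal
          rw [moOn, vol_ball_real _ hb0] at h1
          have hv : 0 < ρ b ^ n * vBall n := by have := vBall_pos n; positivity
          rw [inv_mul_eq_div, lt_div_iff₀ hv] at h1
          exact h1.le
      _ = ∫⁻ y in ⋃ b ∈ u, ball (b : EE n) (ρ b), ENNReal.ofReal |f y - a| :=
          (lintegral_biUnion hcnt (fun _ _ => measurableSet_ball) hdis' _).symm
      _ ≤ ∫⁻ y in ball x (2 * R), ENNReal.ofReal |f y - a| := by
          refine lintegral_mono_set (iUnion₂_subset fun b hb => ball_subset_ball' ?_)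
          have := hρR b (hut hb)
          have h2 := mem_ball.1 (hut hb).1.1
          linarith
      _ ≤ _ := by
          rw [← ofReal_integral_eq_lintegral_ofReal (intOn (locInt_sub hf a) _ _)
            (Eventually.of_forall fun _ => abs_nonneg _), vol_ball _ hR,
            ← ENNReal.ofReal_mul (by positivity)]
          apply ENNReal.ofReal_le_ofReal
          rw [moOn, vol_ball_real _ (by positivity)] at hmo2
          have hv : 0 < (2 * R) ^ n * vBall n := by have := vBall_pos n; positivity
          rw [inv_mul_eq_div, div_le_iff₀ hv] at hmo2
          refine hmo2.trans_eq ?_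
          rw [mul_pow]; ring
  have hS3 : 2 * (ENNReal.ofReal (6 ^ n) * S) ≤ volume (ball x R) := by
    have hc : 0 < 2 ^ n * cA n * M := by positivity
    have h1 : ENNReal.ofReal (cL n * M) =
        ENNReal.ofReal (2 ^ n * cA n * M) * (2 * ENNReal.ofReal (6 ^ n)) := by
      rw [← ENNReal.ofReal_ofNat 2, ← ENNReal.ofReal_mul (by norm_num),
        ← ENNReal.ofReal_mul hc.le, cL]
      congr 1; ring
    rw [h1, mul_assoc] at hS2
    rw [← mul_assoc]
    exact (ENNReal.mul_le_mul_iff_right (ENNReal.ofReal_pos.2 hc).ne' ENNReal.ofReal_ne_top).1 hS2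
  refine hS1.trans ?_
  rw [ENNReal.div_eq_inv_mul, mul_comm 2⁻¹ q, mul_assoc]
  refine mul_le_mul_right ?_ q
  rw [← ENNReal.div_eq_inv_mul, ENNReal.le_div_iff_mul_le (by simp) (by simp), mul_comm]
  exact hS3

lemma jn {n : ℕ} (hn : 1 ≤ n) {f : EE n → ℝ} (hf : LocallyIntegrable f volume) {M : ℝ}
    (hM0 : 0 < M) (hM : IsBMOWith f M) (j : ℕ) :
    DistBd f (j * (cK n * M)) (2⁻¹ ^ j) := by
  have hK : 0 < cK n := by unfold cK cL cA; positivity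
  induction j with
  | zero =>
    intro x r hr
    simp only [pow_zero, one_mul]
    exact measure_mono fun y hy => hy.1
  | succ j ih =>
    have := jn_step hn hf hM0 hM (by positivity) ih
    rw [pow_succ, ← div_eq_mul_inv]
    convert this using 1
    push_cast; ring

lemma summable_aux {s K q : ℝ} (hs : 1 < s) (hK : 0 ≤ K) (hq : 0 < q) (hq1 : q < 1) :
    Summable (fun j : ℕ => (((j : ℝ) + 1) * K) ^ s * q ^ j) := by
  obtain ⟨k, hk⟩ := exists_nat_ge s
  have h1 : Summable (fun j : ℕ => ((j : ℝ) ) ^ k * q ^ j) :=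
    summable_pow_mul_geometric_of_norm_lt_one k (by rwa [Real.norm_of_nonneg hq.le])
  have h2 : Summable (fun j : ℕ => (((j + 1 : ℕ) : ℝ) ) ^ k * q ^ (j + 1)) :=
    (summable_nat_add_iff 1).2 h1
  refine Summable.of_nonneg_of_le (fun j => by positivity) (fun j => ?_)
    (h2.mul_left (K ^ s * q⁻¹))
  rw [Real.mul_rpow (by positivity) hK]
  have h3 : ((j : ℝ) + 1) ^ s ≤ ((j : ℝ) + 1) ^ k := by
    rw [← Real.rpow_natCast]
    exact Real.rpow_le_rpow_of_exponent_le (by linarith [(Nat.cast_nonneg j : (0:ℝ) ≤ j)]) hk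
  calc ((j : ℝ) + 1) ^ s * K ^ s * q ^ j ≤ ((j : ℝ) + 1) ^ k * K ^ s * q ^ j := by gcongr
    _ = _ := by push_cast; rw [pow_succ]; field_simp

lemma jn_Ls {n : ℕ} (hn : 1 ≤ n) {s : ℝ} (hs : 1 < s) :
    ∃ D : ℝ, 0 ≤ D ∧ ∀ (f : EE n → ℝ) (M : ℝ), LocallyIntegrable f volume → 0 < M →
      IsBMOWith f M → ∀ (x : EE n) (r : ℝ), 0 < r →
      ∫⁻ y in ball x r, ENNReal.ofReal (|f y - avgOn f (ball x r)| ^ s)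
        ≤ ENNReal.ofReal (D * M ^ s) * volume (ball x r) := by
  have hK : 0 < cK n := by unfold cK cL cA; positivity
  have hsum := summable_aux (q := 1/2) hs hK.le (by norm_num) (by norm_num)
  refine ⟨∑' j : ℕ, (((j : ℝ) + 1) * cK n) ^ s * (1/2) ^ j,
    tsum_nonneg fun j => by positivity, ?_⟩
  intro f M hf hM0 hM x r hr
  set a := avgOn f (ball x r) with ha
  set T : ℕ → Set (EE n) := fun j => {y | y ∈ ball x r ∧ (j : ℝ) * (cK n * M) < |f y - a|} with hT
  have hTm : ∀ j, NullMeasurableSet (T j) volume := by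
    intro j
    refine measurableSet_ball.nullMeasurableSet.inter ?_
    exact nullMeasurableSet_lt aemeasurable_const
      (locInt_sub hf a).aestronglyMeasurable.aemeasurable
  have hpt : ∀ y ∈ ball x r, ENNReal.ofReal (|f y - a| ^ s) ≤
      ∑' j : ℕ, (T j).indicator
        (fun _ => ENNReal.ofReal ((((j : ℝ) + 1) * (cK n * M)) ^ s)) y := by
    intro y hy
    rcases (abs_nonneg (f y - a)).eq_or_lt with h0 | h0
    · rw [← h0, Real.zero_rpow (by linarith)]; simp
    · have hKM : 0 < cK n * M := by positivity
      have hc : 0 < ⌈|f y - a| / (cK n * M)⌉₊ := Nat.ceil_pos.2 (by positivity)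
      obtain ⟨j, hj⟩ := Nat.exists_eq_succ_of_ne_zero hc.ne'
      have h1 : |f y - a| ≤ ((j : ℝ) + 1) * (cK n * M) := by
        have := Nat.le_ceil (|f y - a| / (cK n * M))
        rw [hj, div_le_iff₀ hKM] at this
        push_cast at this
        exact this
      have h2 : (j : ℝ) * (cK n * M) < |f y - a| := by
        have : j < ⌈|f y - a| / (cK n * M)⌉₊ := by omega
        rwa [Nat.lt_ceil, lt_div_iff₀ hKM] at this
      refine le_trans ?_ (ENNReal.le_tsum j)
      rw [indicator_of_mem (show y ∈ T j from ⟨hy, h2⟩)]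
      gcongr
  calc ∫⁻ y in ball x r, ENNReal.ofReal (|f y - a| ^ s)
      ≤ ∫⁻ y in ball x r, ∑' j : ℕ, (T j).indicator
        (fun _ => ENNReal.ofReal ((((j : ℝ) + 1) * (cK n * M)) ^ s)) y :=
        setLIntegral_mono' measurableSet_ball hpt
    _ ≤ ∫⁻ y, ∑' j : ℕ, (T j).indicator
        (fun _ => ENNReal.ofReal ((((j : ℝ) + 1) * (cK n * M)) ^ s)) y := setLIntegral_le_lintegral _ _
    _ = ∑' j : ℕ, ENNReal.ofReal ((((j : ℝ) + 1) * (cK n * M)) ^ s) * volume (T j) := by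
        rw [lintegral_tsum fun j => aemeasurable_const.indicator₀ (hTm j)]
        congr 1; ext j
        rw [lintegral_indicator_const₀ (hTm j)]
    _ ≤ ∑' j : ℕ, ENNReal.ofReal ((((j : ℝ) + 1) * (cK n * M)) ^ s) *
          (2⁻¹ ^ j * volume (ball x r)) := by
        refine ENNReal.tsum_le_tsum fun j => ?_
        gcongr
        exact jn hn hf hM0 hM j x r hr
    _ = ∑' j : ℕ, ENNReal.ofReal ((((j : ℝ) + 1) * cK n) ^ s * (1/2) ^ j) *
          (ENNReal.ofReal (M ^ s) * volume (ball x r)) := by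
        congr 1; ext j
        have h2 : (2⁻¹ : ℝ≥0∞) ^ j = ENNReal.ofReal ((1/2) ^ j) := by
          rw [ENNReal.ofReal_pow (by norm_num), one_div, ENNReal.ofReal_inv_of_pos (by norm_num)]
          simp
        rw [h2, ← mul_assoc, ← mul_assoc, ← ENNReal.ofReal_mul (by positivity),
          ← mul_assoc (ENNReal.ofReal _) (ENNReal.ofReal (M ^ s)),
          ← ENNReal.ofReal_mul (by positivity),
          Real.mul_rpow (by positivity) hM0.le]
        congr 2; ring
    _ = _ := by
        rw [ENNReal.tsum_mul_right, ← ENNReal.ofReal_tsum_of_nonneg (fun j => by positivity) hsum,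
          ← mul_assoc, ← ENNReal.ofReal_mul (tsum_nonneg fun j => by positivity)]

lemma add_rpow_le_two {a b s : ℝ} (ha : 0 ≤ a) (hb : 0 ≤ b) (hs : 1 < s) :
    (a + b) ^ s ≤ 2 ^ s * (a ^ s + b ^ s) := by
  have h1 : 0 ≤ a ^ s := by positivity
  have h2 : 0 ≤ b ^ s := by positivity
  rcases le_total a b with h | h
  · calc (a + b) ^ s ≤ (2 * b) ^ s := by gcongr; linarith
      _ = 2 ^ s * b ^ s := Real.mul_rpow (by norm_num) hb
      _ ≤ _ := by gcongr; linarith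
  · calc (a + b) ^ s ≤ (2 * a) ^ s := by gcongr; linarith
      _ = 2 ^ s * a ^ s := Real.mul_rpow (by norm_num) ha
      _ ≤ _ := by gcongr; linarith

lemma avg_chain {n : ℕ} {f : EE n → ℝ} (hf : LocallyIntegrable f volume) {M : ℝ}
    (hM : IsBMOWith f M) (x : EE n) {r : ℝ} (hr : 0 < r) (k : ℕ) :
    |avgOn f (ball x (2 ^ k * r)) - avgOn f (ball x r)| ≤ k * (2 ^ n * M) := by
  induction k with
  | zero => simp
  | succ k ih =>
    have h := avg_diff hf hM x x (r := 2 ^ k * r) (R := 2 ^ (k+1) * r) (by positivity) two_pos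
      (by ring) (ball_subset_ball (by
        have : 0 < 2 ^ k * r := by positivity
        rw [pow_succ]; linarith))
    rw [abs_sub_comm] at h
    have := abs_sub_le (avgOn f (ball x (2 ^ (k+1) * r))) (avgOn f (ball x (2 ^ k * r)))
      (avgOn f (ball x r))
    push_cast
    linarith

lemma tail_ball {n : ℕ} (hn : 1 ≤ n) {s : ℝ} (hs : 1 < s) :
    ∃ D : ℝ, 0 ≤ D ∧ ∀ (f : EE n → ℝ) (M : ℝ), LocallyIntegrable f volume → 0 < M →
      IsBMOWith f M → ∀ (x : EE n) (r : ℝ), 0 < r → ∀ k : ℕ,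
      ∫⁻ y in ball x (2 ^ k * r), ENNReal.ofReal (|f y - avgOn f (ball x r)| ^ s)
        ≤ ENNReal.ofReal (D * ((k : ℝ) + 1) ^ s * M ^ s) * volume (ball x (2 ^ k * r)) := by
  obtain ⟨D, hD, H⟩ := jn_Ls hn hs
  refine ⟨2 ^ s * (D + (2 ^ n) ^ s), by positivity, ?_⟩
  intro f M hf hM0 hM x r hr k
  have hR : 0 < 2 ^ k * r := by positivity
  set a := avgOn f (ball x r)
  set m := avgOn f (ball x (2 ^ k * r))
  have hc : |m - a| ≤ k * (2 ^ n * M) := avg_chain hf hM x hr k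
  have hpt : ∀ y, ENNReal.ofReal (|f y - a| ^ s) ≤ ENNReal.ofReal (2 ^ s) *
      (ENNReal.ofReal (|f y - m| ^ s) + ENNReal.ofReal ((k * (2 ^ n * M)) ^ s)) := by
    intro y
    rw [← ENNReal.ofReal_add (by positivity) (by positivity), ← ENNReal.ofReal_mul (by positivity)]
    apply ENNReal.ofReal_le_ofReal
    refine le_trans ?_ (add_rpow_le_two (abs_nonneg _) (by positivity) hs)
    gcongr
    exact (abs_sub_le _ m _).trans (by gcongr)
  calc ∫⁻ y in ball x (2 ^ k * r), ENNReal.ofReal (|f y - a| ^ s)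
      ≤ ∫⁻ y in ball x (2 ^ k * r), ENNReal.ofReal (2 ^ s) *
      (ENNReal.ofReal (|f y - m| ^ s) + ENNReal.ofReal ((k * (2 ^ n * M)) ^ s)) :=
        lintegral_mono hpt
    _ = ENNReal.ofReal (2 ^ s) * ((∫⁻ y in ball x (2 ^ k * r), ENNReal.ofReal (|f y - m| ^ s)) +
        ENNReal.ofReal ((k * (2 ^ n * M)) ^ s) * volume (ball x (2 ^ k * r))) := by
        rw [lintegral_const_mul' _ _ ENNReal.ofReal_ne_top, lintegral_add_right _ measurable_const,
          setLIntegral_const]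
    _ ≤ ENNReal.ofReal (2 ^ s) * (ENNReal.ofReal (D * M ^ s) * volume (ball x (2 ^ k * r)) +
        ENNReal.ofReal ((k * (2 ^ n * M)) ^ s) * volume (ball x (2 ^ k * r))) := by
        gcongr
        exact H f M hf hM0 hM x _ hR
    _ = ENNReal.ofReal (2 ^ s * (D * M ^ s + (k * (2 ^ n * M)) ^ s)) *
          volume (ball x (2 ^ k * r)) := by
        rw [← add_mul, ← ENNReal.ofReal_add (by positivity) (by positivity), ← mul_assoc,
          ← ENNReal.ofReal_mul (by positivity)]
    _ ≤ _ := by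
        gcongr ENNReal.ofReal ?_ * _
        have hk0 : (0:ℝ) ≤ k := Nat.cast_nonneg k
        have h1 : 1 ≤ ((k : ℝ) + 1) ^ s := Real.one_le_rpow (by linarith) (by linarith)
        have h2 : (k * (2 ^ n * M)) ^ s ≤ ((k : ℝ) + 1) ^ s * ((2 ^ n) ^ s * M ^ s) := by
          rw [Real.mul_rpow hk0 (by positivity), Real.mul_rpow (by positivity) hM0.le]
          gcongr; linarith
        have h3 : D * M ^ s ≤ ((k : ℝ) + 1) ^ s * (D * M ^ s) :=
          le_mul_of_one_le_left (by positivity) h1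
        calc 2 ^ s * (D * M ^ s + (k * (2 ^ n * M)) ^ s)
            ≤ 2 ^ s * (((k : ℝ) + 1) ^ s * (D * M ^ s)
              + ((k : ℝ) + 1) ^ s * ((2 ^ n) ^ s * M ^ s)) := by gcongr
          _ = _ := by ring

lemma tail_lintegral {n : ℕ} (hn : 1 ≤ n) {s : ℝ} (hs : 1 < s) :
    ∃ T : ℝ, 0 ≤ T ∧ ∀ (f : EE n → ℝ) (M : ℝ), LocallyIntegrable f volume → 0 < M →
      IsBMOWith f M → ∀ (x₀ : EE n) (r₀ : ℝ), 0 < r₀ → ∀ x ∈ ball x₀ r₀,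
        (∫⁻ y, ENNReal.ofReal
              (|Set.indicator (Metric.ball x₀ (4 * r₀))ᶜ
                  (fun z => f z - avgOn f (Metric.ball x₀ r₀)) y| ^ s /
                ‖x - y‖ ^ ((n : ℝ) + s - 1)))
          ≤ ENNReal.ofReal (T * (M ^ s * r₀ ^ (-(s - 1)))) := by
  obtain ⟨D, hD, H⟩ := tail_ball hn hs
  have hv := vBall_pos n
  set q : ℝ := 2 ^ (-(s - 1)) with hq
  have hq0 : 0 < q := by positivity
  have hq1 : q < 1 := Real.rpow_lt_one_of_one_lt_of_neg (by norm_num) (by linarith)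
  have hsum := (summable_aux (K := 4) hs (by norm_num) hq0 hq1).mul_left (D * 4 ^ n * vBall n)
  refine ⟨∑' k : ℕ, D * 4 ^ n * vBall n * ((((k : ℝ) + 1) * 4) ^ s * q ^ k),
    tsum_nonneg fun k => by positivity, ?_⟩
  intro f M hf hM0 hM x₀ r hr x hx
  set a := avgOn f (ball x₀ r)
  set e : ℝ := (n : ℝ) + s - 1 with he
  have hn0 : (0 : ℝ) ≤ n := Nat.cast_nonneg n
  have he0 : 0 < e := by rw [he]; linarith
  set c : ℕ → ℝ := fun k => ((2 ^ (k + 1) * r) ^ e)⁻¹ with hcdef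
  have hpt : ∀ y, ENNReal.ofReal (|Set.indicator (Metric.ball x₀ (4 * r))ᶜ
      (fun z => f z - a) y| ^ s / ‖x - y‖ ^ e) ≤
      ∑' k : ℕ, (ball x₀ (2 ^ (k + 3) * r)).indicator
        (fun y => ENNReal.ofReal (c k) * ENNReal.ofReal (|f y - a| ^ s)) y := by
    intro y
    by_cases hy : y ∈ ball x₀ (4 * r)
    · rw [indicator_of_notMem (by simpa using hy)]
      simp [Real.zero_rpow (by linarith : s ≠ 0)]
    · rw [indicator_of_mem (by simpa using hy)]
      have hy' : 4 * r ≤ dist y x₀ := by simpa using hy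
      obtain ⟨k, hk1, hk2⟩ := exists_nat_pow_near (x := dist y x₀ / (4 * r)) (y := (2:ℝ))
        (by rw [le_div_iff₀ (by positivity)]; linarith) (by norm_num)
      rw [le_div_iff₀ (by positivity)] at hk1
      rw [div_lt_iff₀ (by positivity)] at hk2
      refine le_trans ?_ (ENNReal.le_tsum k)
      rw [indicator_of_mem (by rw [mem_ball]; refine hk2.trans_eq ?_; ring),
        ← ENNReal.ofReal_mul (by positivity)]
      apply ENNReal.ofReal_le_ofReal
      rw [div_eq_mul_inv, mul_comm]
      have hd : 2 ^ (k + 1) * r ≤ ‖x - y‖ := by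
        have h1 := dist_triangle y x x₀
        have h2 := mem_ball.1 hx
        rw [← dist_eq_norm, dist_comm x y]
        have h3 : (1:ℝ) ≤ 2 ^ k := one_le_pow₀ (by norm_num)
        have h4 : r ≤ 2 ^ k * r := le_mul_of_one_le_left hr.le h3
        rw [pow_succ]
        linarith
      have : 0 < 2 ^ (k + 1) * r := by positivity
      simp only [hcdef]
      gcongr
  have hcoef : ∀ k : ℕ, c k * ((D * (((k + 3 : ℕ) : ℝ) + 1) ^ s * M ^ s) *
      ((2 ^ (k + 3) * r) ^ n * vBall n)) ≤
      D * 4 ^ n * vBall n * ((((k : ℝ) + 1) * 4) ^ s * q ^ k) * (M ^ s * r ^ (-(s - 1))) := by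
    intro k
    have hz : 0 < 2 ^ (k + 1) * r := by positivity
    have h1 : c k * (2 ^ (k + 3) * r) ^ n = 4 ^ n * (2 ^ (k + 1) * r) ^ (-(s - 1)) := by
      have : (2 : ℝ) ^ (k + 3) * r = 4 * (2 ^ (k + 1) * r) := by ring
      rw [this, mul_pow]
      simp only [hcdef]
      rw [← Real.rpow_neg hz.le, ← Real.rpow_natCast (2 ^ (k + 1) * r) n, mul_left_comm,
        ← Real.rpow_add hz]
      congr 2
      rw [he]; ring
    have h2 : (2 ^ (k + 1) * r) ^ (-(s - 1)) ≤ q ^ k * r ^ (-(s - 1)) := by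
      rw [Real.mul_rpow (by positivity) hr.le, ← Real.rpow_natCast, ← Real.rpow_mul (by norm_num),
        mul_comm _ (-(s-1)), Real.rpow_mul (by norm_num), Real.rpow_natCast, pow_succ]
      gcongr
      exact mul_le_of_le_one_right (by positivity) hq1.le
    have h3 : (((k + 3 : ℕ) : ℝ) + 1) ^ s ≤ (((k : ℝ) + 1) * 4) ^ s := by
      push_cast
      gcongr
      have hk0 : (0:ℝ) ≤ k := Nat.cast_nonneg k
      linarith
    calc c k * ((D * (((k + 3 : ℕ) : ℝ) + 1) ^ s * M ^ s) * ((2 ^ (k + 3) * r) ^ n * vBall n))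
        = (D * (((k + 3 : ℕ) : ℝ) + 1) ^ s * M ^ s * vBall n) * (c k * (2 ^ (k + 3) * r) ^ n) := by
          ring
      _ = (D * (((k + 3 : ℕ) : ℝ) + 1) ^ s * M ^ s * vBall n) *
          (4 ^ n * (2 ^ (k + 1) * r) ^ (-(s - 1))) := by rw [h1]
      _ ≤ (D * (((k : ℝ) + 1) * 4) ^ s * M ^ s * vBall n) *
          (4 ^ n * (q ^ k * r ^ (-(s - 1)))) := by gcongr
      _ = _ := by ring
  calc _ ≤ ∫⁻ y, ∑' k : ℕ, (ball x₀ (2 ^ (k + 3) * r)).indicator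
        (fun y => ENNReal.ofReal (c k) * ENNReal.ofReal (|f y - a| ^ s)) y := lintegral_mono hpt
    _ = ∑' k : ℕ, ENNReal.ofReal (c k) *
        ∫⁻ y in ball x₀ (2 ^ (k + 3) * r), ENNReal.ofReal (|f y - a| ^ s) := by
        rw [lintegral_tsum]
        · congr 1; ext k
          rw [lintegral_indicator measurableSet_ball,
            lintegral_const_mul' _ _ ENNReal.ofReal_ne_top]
        · intro k
          refine AEMeasurable.indicator ?_ measurableSet_ball
          exact (((locInt_sub hf a).aestronglyMeasurable.aemeasurable.pow_const
            s).ennreal_ofReal).const_mul _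
    _ ≤ ∑' k : ℕ, ENNReal.ofReal (D * 4 ^ n * vBall n * ((((k : ℝ) + 1) * 4) ^ s * q ^ k)) *
          ENNReal.ofReal (M ^ s * r ^ (-(s - 1))) := by
        refine ENNReal.tsum_le_tsum fun k => ?_
        have hck : 0 ≤ c k := by simp only [hcdef]; positivity
        refine (mul_le_mul_right (H f M hf hM0 hM x₀ r hr (k + 3)) _).trans ?_
        rw [vol_ball _ (by positivity), ← ENNReal.ofReal_mul (by positivity),
          ← ENNReal.ofReal_mul hck, ← ENNReal.ofReal_mul (by positivity)]
        exact ENNReal.ofReal_le_ofReal (hcoef k)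
    _ = _ := by
        rw [ENNReal.tsum_mul_right, ← ENNReal.ofReal_tsum_of_nonneg (fun j => by positivity) hsum,
          ← ENNReal.ofReal_mul (tsum_nonneg fun j => by positivity)]

/-- let `f ∈ BMO(ℝⁿ)` with norm at most `M`, `B = B(x₀,r₀)`,
`B^{**} = B(x₀,4r₀)`, `f₂ = (f - f_B) χ_{(B^{**})^c}` and `1 < s < ∞`. Then for `x ∈ B`,
`(∫_{ℝⁿ} |f₂(y)|^s / |x-y|^{n+s-1} dy)^{1/s} · r₀^{1/s'} ≤ C M` with `1/s + 1/s' = 1`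
and `C` depending only on `n` and `s`. -/
theorem bmo_fractional_tail_estimate (n : ℕ) (hn : 1 ≤ n) (s s' : ℝ) (hs : 1 < s)
    (hs' : 1 / s + 1 / s' = 1) :
    ∃ C > 0, ∀ (f : EuclideanSpace ℝ (Fin n) → ℝ) (M : ℝ),
      LocallyIntegrable f volume → IsBMOWith f M →
      ∀ (x₀ : EuclideanSpace ℝ (Fin n)) (r₀ : ℝ), 0 < r₀ →
      ∀ x ∈ Metric.ball x₀ r₀,
        (∫⁻ y, ENNReal.ofReal
              (|Set.indicator (Metric.ball x₀ (4 * r₀))ᶜ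
                  (fun z => f z - avgOn f (Metric.ball x₀ r₀)) y| ^ s /
                ‖x - y‖ ^ ((n : ℝ) + s - 1))) ^ (1 / s) *
            ENNReal.ofReal (r₀ ^ (1 / s'))
          ≤ ENNReal.ofReal (C * M) := by
  obtain ⟨T, hT, H⟩ := tail_lintegral hn hs
  refine ⟨T ^ (1 / s) + 1, by positivity, ?_⟩
  intro f M hf hM x₀ r₀ hr x hx
  have hs0 : 0 < s := by linarith
  have hMnn : 0 ≤ M := (moOn_nonneg f _ x₀ r₀).trans (hM x₀ r₀ hr)
  have key : ∀ M' : ℝ, M < M' → (∫⁻ y, ENNReal.ofReal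
              (|Set.indicator (Metric.ball x₀ (4 * r₀))ᶜ
                  (fun z => f z - avgOn f (Metric.ball x₀ r₀)) y| ^ s /
                ‖x - y‖ ^ ((n : ℝ) + s - 1))) ^ (1 / s) *
            ENNReal.ofReal (r₀ ^ (1 / s'))
          ≤ ENNReal.ofReal ((T ^ (1 / s) + 1) * M') := by
    intro M' hMM
    have hM0 : 0 < M' := by linarith
    have h1 := H f M' hf hM0 (fun z r h => (hM z r h).trans hMM.le) x₀ r₀ hr x hx
    refine (mul_le_mul_left (ENNReal.rpow_le_rpow h1 (by positivity)) _).trans ?_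
    rw [ENNReal.ofReal_rpow_of_nonneg (by positivity) (by positivity),
      ← ENNReal.ofReal_mul (by positivity)]
    apply ENNReal.ofReal_le_ofReal
    rw [Real.mul_rpow hT (by positivity), Real.mul_rpow (by positivity) (by positivity),
      ← Real.rpow_mul hM0.le, ← Real.rpow_mul hr.le, mul_one_div_cancel hs0.ne', Real.rpow_one,
      mul_assoc, mul_assoc, ← Real.rpow_add hr]
    have h2 : -(s - 1) * (1 / s) + 1 / s' = 0 := by
      have : 1 / s' = 1 - 1 / s := by linarith
      rw [this]; field_simp; ring
    rw [h2, Real.rpow_zero, mul_one]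
    gcongr
    linarith
  have hlim : Tendsto (fun M' : ℝ => ENNReal.ofReal ((T ^ (1 / s) + 1) * M')) (𝓝[>] M)
      (𝓝 (ENNReal.ofReal ((T ^ (1 / s) + 1) * M))) := by
    refine Tendsto.mono_left ?_ nhdsWithin_le_nhds
    exact (ENNReal.continuous_ofReal.comp (continuous_const.mul continuous_id)).tendsto M
  refine ge_of_tendsto hlim ?_
  filter_upwards [self_mem_nhdsWithin] with M' hM'
  exact key M' hM'

end
end
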